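/- arXiv:2311.05531 — 7 statements merged into one kernel-verified Lean document; each statement's English description precedes it below -/
import Mathlib

section
/- Let r ∈ ℕ^m, c ∈ ℕ^n with equal coordinate sums, let M = (m_{ij}) ∈ BCT(r,c), and let i<j be rows and k<l be columns with m_{ik}=0, m_{il}=1, m_{jk}=1, m_{jl}=0. Let M' be obtained from M by the L2→I2 interchange at rows i,j and columns k,l. Then M covers M' in the combinatorial secondary Bruhat order on BCT(r,c) (i.e., M' <_{secB} M and there is no M'' with M' <_{secB} M'' <_{secB} M) if and only if the following four conditions all hold: (1) m_{pk}=m_{pl} for all i<p<j; (2) m_{iq}=m_{jq} for all k<q<l; (3) for all i<p<j and k<q<l, if m_{pk}=0 and m_{iq}=0 then m_{pq}=0; (4) for all i<p<j and k<q<l, if m_{pk}=1 and m_{iq}=1 then m_{pq}=1. -/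
open Finset

/-- `M` is a 0-1 matrix with row sum vector `r` and column sum vector `c`. -/
def isBCT {m n : ℕ} (r : Fin m → ℕ) (c : Fin n → ℕ) (M : Fin m → Fin n → ℕ) : Prop :=
  (∀ i j, M i j = 0 ∨ M i j = 1) ∧ (∀ i, ∑ j, M i j = r i) ∧ (∀ j, ∑ i, M i j = c j)

/-- `M'` is obtained from `M` by a single `L2 → I2` interchange. -/
def InterchangeStep {m n : ℕ} (M M' : Fin m → Fin n → ℕ) : Prop :=
  ∃ (i j : Fin m) (k l : Fin n), i < j ∧ k < l ∧
    M i k = 0 ∧ M i l = 1 ∧ M j k = 1 ∧ M j l = 0 ∧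
    M' i k = 1 ∧ M' i l = 0 ∧ M' j k = 0 ∧ M' j l = 1 ∧
    (∀ p q, ¬((p = i ∨ p = j) ∧ (q = k ∨ q = l)) → M' p q = M p q)

/-- The combinatorial secondary Bruhat order: `M1 ≤ M2` iff `M1` is obtained from `M2`
by a (possibly empty) finite sequence of `L2 → I2` interchanges. -/
def secBLE {m n : ℕ} (M1 M2 : Fin m → Fin n → ℕ) : Prop :=
  Relation.ReflTransGen InterchangeStep M2 M1

/-- `σ(M)_{ij} = ∑_{k ≤ i} ∑_{l ≤ j} m_{kl}`. -/
def sigmaM {m n : ℕ} (M : Fin m → Fin n → ℕ) (i : Fin m) (j : Fin n) : ℕ :=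
  ∑ k ∈ Finset.univ.filter (fun k : Fin m => k ≤ i),
    ∑ l ∈ Finset.univ.filter (fun l : Fin n => l ≤ j), M k l

/-- The combinatorial Bruhat order: `M1 ≤_B M2` iff `σ(M1) ≥ σ(M2)` entrywise. -/
def bruhatLE {m n : ℕ} (M1 M2 : Fin m → Fin n → ℕ) : Prop :=
  ∀ i j, sigmaM M2 i j ≤ sigmaM M1 i j

/-- The matrix obtained from `M` by overwriting the entries in rows `i`, `j` and columns
`k`, `l` with the pattern `I2`. -/
def interchange {m n : ℕ} (M : Fin m → Fin n → ℕ) (i j : Fin m) (k l : Fin n) :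
    Fin m → Fin n → ℕ := fun p q =>
  if (p = i ∧ q = k) ∨ (p = j ∧ q = l) then 1
  else if (p = i ∧ q = l) ∨ (p = j ∧ q = k) then 0
  else M p q

section Interchange

variable {m n : ℕ} {M N : Fin m → Fin n → ℕ} {i j : Fin m} {k l : Fin n}

theorem interchangeStep_interchange (hij : i < j) (hkl : k < l)
    (hik : M i k = 0) (hil : M i l = 1) (hjk : M j k = 1) (hjl : M j l = 0) :
    InterchangeStep M (interchange M i j k l) := by
  have h1 := hij.ne
  have h2 := hkl.ne
  refine ⟨i, j, k, l, hij, hkl, hik, hil, hjk, hjl, ?_, ?_, ?_, ?_, ?_⟩ <;>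
    simp only [interchange] <;> grind

theorem InterchangeStep.exists_eq_interchange (h : InterchangeStep M N) :
    ∃ (i j : Fin m) (k l : Fin n), i < j ∧ k < l ∧
      M i k = 0 ∧ M i l = 1 ∧ M j k = 1 ∧ M j l = 0 ∧ N = interchange M i j k l := by
  obtain ⟨i, j, k, l, hij, hkl, hik, hil, hjk, hjl, h1, h2, h3, h4, h5⟩ := h
  refine ⟨i, j, k, l, hij, hkl, hik, hil, hjk, hjl, ?_⟩
  funext p q
  have := h5 p q
  simp only [interchange]
  grind

theorem InterchangeStep.ne (h : InterchangeStep M N) : N ≠ M := by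
  obtain ⟨i, j, k, l, -, -, hik, -, -, -, h1, -⟩ := h
  rintro rfl
  omega

theorem interchange_cast_eq (hij : i < j) (hkl : k < l)
    (hik : M i k = 0) (hil : M i l = 1) (hjk : M j k = 1) (hjl : M j l = 0)
    (p : Fin m) (q : Fin n) :
    (interchange M i j k l p q : ℤ) = M p q +
      ((if i = p then 1 else 0) - (if j = p then 1 else 0)) *
      ((if k = q then 1 else 0) - (if l = q then 1 else 0)) := by
  have h1 := hij.ne
  have h2 := hkl.ne
  simp only [interchange]
  by_cases hpi : i = p
  · subst hpi
    by_cases hqk : k = q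
    · subst hqk; simp [hik, h1.symm, h2.symm]
    · by_cases hql : l = q
      · subst hql; simp [hil, h1, h1.symm, h2, h2.symm]
      · simp [hqk, hql, Ne.symm hqk, Ne.symm hql]
  · by_cases hpj : j = p
    · subst hpj
      by_cases hqk : k = q
      · subst hqk; simp [hjk, h1, h1.symm, h2, h2.symm]
      · by_cases hql : l = q
        · subst hql; simp [hjl, h1, h2]
        · simp [hqk, hql, Ne.symm hqk, Ne.symm hql]
    · simp [hpi, hpj, Ne.symm hpi, Ne.symm hpj]

theorem sigmaM_interchange (hij : i < j) (hkl : k < l)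
    (hik : M i k = 0) (hil : M i l = 1) (hjk : M j k = 1) (hjl : M j l = 0)
    (a : Fin m) (b : Fin n) :
    sigmaM (interchange M i j k l) a b =
      sigmaM M a b + if (i ≤ a ∧ a < j) ∧ (k ≤ b ∧ b < l) then 1 else 0 := by
  zify
  simp only [sigmaM, Nat.cast_sum, interchange_cast_eq hij hkl hik hil hjk hjl,
    Finset.sum_add_distrib, ← Finset.mul_sum, ← Finset.sum_mul, Finset.sum_sub_distrib,
    Finset.sum_ite_eq, Finset.mem_filter, Finset.mem_univ, true_and, add_right_inj]
  split_ifs <;> omega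

theorem InterchangeStep.isBCT {r : Fin m → ℕ} {c : Fin n → ℕ} (hM : isBCT r c M)
    (h : InterchangeStep M N) : isBCT r c N := by
  obtain ⟨i, j, k, l, hij, hkl, hik, hil, hjk, hjl, rfl⟩ := h.exists_eq_interchange
  obtain ⟨h01, hr, hc⟩ := hM
  refine ⟨fun p q => ?_, fun p => ?_, fun q => ?_⟩
  · have := h01 p q
    simp only [interchange]
    grind
  · rw [← hr p]
    zify
    simp [interchange_cast_eq hij hkl hik hil hjk hjl, Finset.sum_add_distrib,
      ← Finset.mul_sum]
  · rw [← hc q]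
    zify
    simp [interchange_cast_eq hij hkl hik hil hjk hjl, Finset.sum_add_distrib,
      ← Finset.sum_mul]

theorem InterchangeStep.bruhatLE (h : InterchangeStep M N) : bruhatLE N M := by
  obtain ⟨i, j, k, l, hij, hkl, hik, hil, hjk, hjl, rfl⟩ := h.exists_eq_interchange
  intro a b
  rw [sigmaM_interchange hij hkl hik hil hjk hjl]
  omega

theorem secBLE.bruhatLE (h : secBLE N M) : bruhatLE N M := by
  unfold secBLE at h
  induction h with
  | refl => exact fun _ _ => le_rfl
  | tail _ h ih => exact fun a b => (ih a b).trans (h.bruhatLE a b)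

theorem secBLE.antisymm (h : secBLE N M) (h' : secBLE M N) : N = M := by
  rcases Relation.ReflTransGen.cases_head h with h | ⟨K, hK, hKN⟩
  · exact h.symm
  · obtain ⟨i, j, k, l, hij, hkl, hik, hil, hjk, hjl, rfl⟩ := hK.exists_eq_interchange
    have h1 := secBLE.bruhatLE hKN i k
    have h2 := h'.bruhatLE i k
    rw [sigmaM_interchange hij hkl hik hil hjk hjl, if_pos ⟨⟨le_rfl, hij⟩, le_rfl, hkl⟩] at h1
    omega

/-- A window with corner pattern `L2` in rows `i`, `j` and columns `k`, `l` whose interior entries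
are compatible with its border as in the Brualdi–Deaett criterion. -/
structure CoverWindow (M : Fin m → Fin n → ℕ) (i j : Fin m) (k l : Fin n) : Prop where
  entries : ∀ p q, M p q = 0 ∨ M p q = 1
  row_lt : i < j
  col_lt : k < l
  top_left : M i k = 0
  top_right : M i l = 1
  bottom_left : M j k = 1
  bottom_right : M j l = 0
  left_eq_right : ∀ p, i < p → p < j → M p k = M p l
  top_eq_bottom : ∀ q, k < q → q < l → M i q = M j q
  zero : ∀ p q, i < p → p < j → k < q → q < l → M p k = 0 → M i q = 0 → M p q = 0
  one : ∀ p q, i < p → p < j → k < q → q < l → M p k = 1 → M i q = 1 → M p q = 1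

/-- An interchange inside a cover window is either the one at its corners, or it takes place in
the interior of the window and avoids the entries forced by the border. -/
theorem CoverWindow.eq_or_interior (h : CoverWindow M i j k l) {a b : Fin m} {c d : Fin n}
    (hab : a < b) (hcd : c < d) (hia : i ≤ a) (hbj : b ≤ j) (hkc : k ≤ c) (hdl : d ≤ l)
    (hac : M a c = 0) (had : M a d = 1) (hbc : M b c = 1) (hbd : M b d = 0) :
    (a = i ∧ b = j ∧ c = k ∧ d = l) ∨
      ((i < a ∧ b < j ∧ k < c ∧ d < l) ∧
        M a k ≠ M i c ∧ M a k ≠ M i d ∧ M b k ≠ M i c ∧ M b k ≠ M i d) := by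
  obtain ⟨h01, hij, hkl, hik, hil, hjk, hjl, h1, h2, h3, h4⟩ := h
  have := h1 a
  have := h1 b
  have := h2 c
  have := h2 d
  have := h3 a c
  have := h3 a d
  have := h3 b c
  have := h3 b d
  have := h4 a c
  have := h4 a d
  have := h4 b c
  have := h4 b d
  have := h01 a k
  have := h01 b k
  have := h01 i c
  have := h01 i d
  rcases hia.eq_or_lt with rfl | hia <;> rcases hbj.eq_or_lt with rfl | hbj <;>
    rcases hkc.eq_or_lt with rfl | hkc <;> rcases hdl.eq_or_lt with rfl | hdl <;>
    grind

theorem CoverWindow.interchange (h : CoverWindow M i j k l) {a b : Fin m} {c d : Fin n}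
    (hab : a < b) (hcd : c < d) (hia : i < a) (hbj : b < j) (hkc : k < c) (hdl : d < l)
    (h1 : M a k ≠ M i c) (h2 : M a k ≠ M i d) (h3 : M b k ≠ M i c) (h4 : M b k ≠ M i d) :
    CoverWindow (interchange M a b c d) i j k l := by
  have hrow : ∀ p, p = i ∨ p = j → ∀ q, _root_.interchange M a b c d p q = M p q := by
    intro p hp q
    simp only [_root_.interchange]
    grind
  have hcol : ∀ q, q = k ∨ q = l → ∀ p, _root_.interchange M a b c d p q = M p q := by
    intro q hq p
    simp only [_root_.interchange]
    grind
  have hfree : ∀ p q, M p k = M i q → _root_.interchange M a b c d p q = M p q := by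
    intro p q hpq
    simp only [_root_.interchange]
    grind
  have ht := hrow i (.inl rfl)
  have hb := hrow j (.inr rfl)
  have hl := hcol k (.inl rfl)
  have hr := hcol l (.inr rfl)
  refine ⟨fun p q => ?_, h.row_lt, h.col_lt, ?_, ?_, ?_, ?_, fun p hp hp' => ?_,
    fun q hq hq' => ?_, fun p q hp hp' hq hq' hpk hiq => ?_, fun p q hp hp' hq hq' hpk hiq => ?_⟩
  · have := h.entries p q
    simp only [_root_.interchange]
    grind
  · rw [ht, h.top_left]
  · rw [ht, h.top_right]
  · rw [hb, h.bottom_left]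
  · rw [hb, h.bottom_right]
  · rw [hl, hr, h.left_eq_right p hp hp']
  · rw [ht, hb, h.top_eq_bottom q hq hq']
  · rw [hl] at hpk
    rw [ht] at hiq
    rw [hfree p q (hpk.trans hiq.symm), h.zero p q hp hp' hq hq' hpk hiq]
  · rw [hl] at hpk
    rw [ht] at hiq
    rw [hfree p q (hpk.trans hiq.symm), h.one p q hp hp' hq hq' hpk hiq]

/-- A step from a cover window to a matrix above a matrix whose `sigmaM` exceeds that of `M` only
on the window, and by at most one, takes place inside the window. -/
theorem CoverWindow.step_cases (h : CoverWindow M i j k l) {K : Fin m → Fin n → ℕ}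
    (hK : InterchangeStep M K) (hNK : secBLE N K)
    (hle : ∀ a b, sigmaM N a b ≤
      sigmaM M a b + if (i ≤ a ∧ a < j) ∧ (k ≤ b ∧ b < l) then 1 else 0) :
    K = _root_.interchange M i j k l ∨
      (CoverWindow K i j k l ∧ sigmaM K i k = sigmaM M i k ∧
        ∃ a b, (i ≤ a ∧ a < j) ∧ (k ≤ b ∧ b < l) ∧ sigmaM M a b < sigmaM K a b) := by
  obtain ⟨a, b, c, d, hab, hcd, hac, had, hbc, hbd, rfl⟩ := hK.exists_eq_interchange
  have hs := sigmaM_interchange hab hcd hac had hbc hbd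
  have hmem : ∀ p q, a ≤ p → p < b → c ≤ q → q < d → (i ≤ p ∧ p < j) ∧ (k ≤ q ∧ q < l) := by
    intro p q hp hp' hq hq'
    by_contra hcon
    have h1 := hle p q
    have h2 := hNK.bruhatLE p q
    rw [hs, if_pos ⟨⟨hp, hp'⟩, hq, hq'⟩] at h2
    rw [if_neg hcon] at h1
    omega
  have hfirst := hmem a c le_rfl hab le_rfl hcd
  have hbj : b ≤ j := by
    by_contra! hcon
    exact absurd (hmem j c hfirst.1.2.le hcon le_rfl hcd).1.2 (lt_irrefl j)
  have hdl : d ≤ l := by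
    by_contra! hcon
    exact absurd (hmem a l le_rfl hab hfirst.2.2.le hcon).2.2 (lt_irrefl l)
  rcases h.eq_or_interior hab hcd hfirst.1.1 hbj hfirst.2.1 hdl hac had hbc hbd with
    ⟨rfl, rfl, rfl, rfl⟩ | ⟨⟨hia, hbj, hkc, hdl⟩, h1, h2, h3, h4⟩
  · exact .inl rfl
  · refine .inr ⟨h.interchange hab hcd hia hbj hkc hdl h1 h2 h3 h4, ?_, a, c, hfirst.1,
      hfirst.2, ?_⟩
    · rw [hs, if_neg (fun hcon => hia.not_ge hcon.1.1), add_zero]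
    · rw [hs, if_pos ⟨⟨le_rfl, hab⟩, le_rfl, hcd⟩]
      omega

theorem CoverWindow.sigmaM_ge (h : CoverWindow M i j k l) (hNM : secBLE N M)
    (hle : ∀ a b, sigmaM N a b ≤
      sigmaM M a b + if (i ≤ a ∧ a < j) ∧ (k ≤ b ∧ b < l) then 1 else 0)
    (hlt : sigmaM M i k < sigmaM N i k) (a : Fin m) (b : Fin n) :
    sigmaM M a b + (if (i ≤ a ∧ a < j) ∧ (k ≤ b ∧ b < l) then 1 else 0) ≤ sigmaM N a b := by
  unfold secBLE at hNM
  induction hNM using Relation.ReflTransGen.head_induction_on with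
  | refl => exact absurd hlt (lt_irrefl _)
  | head hK hNK ih =>
    rcases h.step_cases hK hNK hle with rfl | ⟨hw, hs, -⟩
    · rw [← sigmaM_interchange h.row_lt h.col_lt h.top_left h.top_right h.bottom_left
        h.bottom_right]
      exact secBLE.bruhatLE hNK a b
    · have := ih hw (fun p q => (hle p q).trans (Nat.add_le_add_right (hK.bruhatLE p q) _))
        (hs ▸ hlt)
      exact (Nat.add_le_add_right (hK.bruhatLE a b) _).trans this

theorem CoverWindow.eq_interchange_of_step (h : CoverWindow M i j k l)
    {K : Fin m → Fin n → ℕ} (hK : InterchangeStep M K)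
    (hle : secBLE (_root_.interchange M i j k l) K) : K = _root_.interchange M i j k l := by
  have hs := sigmaM_interchange h.row_lt h.col_lt h.top_left h.top_right h.bottom_left
    h.bottom_right
  rcases h.step_cases hK hle (fun a b => (hs a b).le) with hK' | ⟨hw, hik, a, b, ha, hb, hlt⟩
  · exact hK'
  · have hge := hw.sigmaM_ge hle
      (fun p q => (hs p q).le.trans (Nat.add_le_add_right (hK.bruhatLE p q) _))
      (by rw [hik, hs, if_pos ⟨⟨le_rfl, h.row_lt⟩, le_rfl, h.col_lt⟩]; omega) a b
    rw [hs] at hge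
    omega

end Interchange

/-- Brualdi–Deaett cover criterion for the combinatorial secondary Bruhat order. -/
theorem brualdi_deaett_cover {m n : ℕ} (r : Fin m → ℕ) (c : Fin n → ℕ)
    (hsum : ∑ i, r i = ∑ j, c j)
    (M M' : Fin m → Fin n → ℕ) (hM : isBCT r c M)
    (i j : Fin m) (k l : Fin n) (hij : i < j) (hkl : k < l)
    (hik : M i k = 0) (hil : M i l = 1) (hjk : M j k = 1) (hjl : M j l = 0)
    (hM' : M' = fun p q =>
      if (p = i ∧ q = k) ∨ (p = j ∧ q = l) then 1
      else if (p = i ∧ q = l) ∨ (p = j ∧ q = k) then 0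
      else M p q) :
    ((secBLE M' M ∧ M' ≠ M) ∧
      ¬ ∃ M'' : Fin m → Fin n → ℕ, isBCT r c M'' ∧
        (secBLE M' M'' ∧ M' ≠ M'') ∧ (secBLE M'' M ∧ M'' ≠ M))
    ↔ ((∀ p : Fin m, i < p → p < j → M p k = M p l) ∧
       (∀ q : Fin n, k < q → q < l → M i q = M j q) ∧
       (∀ (p : Fin m) (q : Fin n), i < p → p < j → k < q → q < l →
          M p k = 0 → M i q = 0 → M p q = 0) ∧
       (∀ (p : Fin m) (q : Fin n), i < p → p < j → k < q → q < l →
          M p k = 1 → M i q = 1 → M p q = 1)) := by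
  have hne := hij.ne
  have hne' := hkl.ne
  change M' = interchange M i j k l at hM'
  have hstep : InterchangeStep M M' :=
    hM' ▸ interchangeStep_interchange hij hkl hik hil hjk hjl
  have h01 := hM.1
  constructor
  · rintro ⟨-, hcov⟩
    have hno : ∀ K, InterchangeStep M K → secBLE M' K → M' = K := by
      intro K hK hle
      by_contra hcon
      exact hcov ⟨K, hK.isBCT hM, ⟨hle, hcon⟩, .single hK, hK.ne⟩
    have hrows : ∀ p : Fin m, i < p → p < j → M p k = M p l := by
      intro p hip hpj
      by_contra hcon
      have hne1 := hip.ne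
      have hne2 := hpj.ne
      have hk := h01 p k
      have hl := h01 p l
      rcases hk with hk | hk
      · have hl : M p l = 1 := by omega
        have hK := interchangeStep_interchange hpj hkl hk hl hjk hjl
        have hK' : InterchangeStep (interchange M p j k l) M' := by
          refine ⟨i, p, k, l, hip, hkl, ?_⟩
          rw [hM']
          simp only [interchange]
          grind
        exact hK'.ne (hno _ hK (.single hK'))
      · have hl : M p l = 0 := by omega
        have hK := interchangeStep_interchange hip hkl hik hil hk hl
        have hK' : InterchangeStep (interchange M i p k l) M' := by
          refine ⟨p, j, k, l, hpj, hkl, ?_⟩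
          rw [hM']
          simp only [interchange]
          grind
        exact hK'.ne (hno _ hK (.single hK'))
    have hcols : ∀ q : Fin n, k < q → q < l → M i q = M j q := by
      intro q hkq hql
      by_contra hcon
      have hne1 := hkq.ne
      have hne2 := hql.ne
      have hi := h01 i q
      have hj := h01 j q
      rcases hi with hi | hi
      · have hj : M j q = 1 := by omega
        have hK := interchangeStep_interchange hij hql hi hil hj hjl
        have hK' : InterchangeStep (interchange M i j q l) M' := by
          refine ⟨i, j, k, q, hij, hkq, ?_⟩
          rw [hM']
          simp only [interchange]
          grind
        exact hK'.ne (hno _ hK (.single hK'))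
      · have hj : M j q = 0 := by omega
        have hK := interchangeStep_interchange hij hkq hik hi hjk hj
        have hK' : InterchangeStep (interchange M i j k q) M' := by
          refine ⟨i, j, q, l, hij, hql, ?_⟩
          rw [hM']
          simp only [interchange]
          grind
        exact hK'.ne (hno _ hK (.single hK'))
    refine ⟨hrows, hcols, ?_, ?_⟩
    · intro p q hip hpj hkq hql hpk hiq
      by_contra hcon
      have hpq : M p q = 1 := (h01 p q).resolve_left hcon
      have hpl : M p l = 0 := (hrows p hip hpj).symm.trans hpk
      have hjq : M j q = 0 := (hcols q hkq hql).symm.trans hiq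
      have hne1 := hip.ne
      have hne2 := hpj.ne
      have hne3 := hkq.ne
      have hne4 := hql.ne
      have hK := interchangeStep_interchange hip hql hiq hil hpq hpl
      have hL : InterchangeStep (interchange M i p q l)
          (interchange (interchange M i p q l) i j k q) := by
        apply interchangeStep_interchange hij hkq <;> simp only [interchange] <;> grind
      have hN : InterchangeStep (interchange (interchange M i p q l) i j k q) M' := by
        refine ⟨p, j, q, l, hpj, hql, ?_⟩
        rw [hM']
        simp only [interchange]
        grind
      have heq := hno _ hK (.head hL (.single hN))
      have hle : secBLE M' _ := .single hN
      rw [heq] at hle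
      exact hL.ne (secBLE.antisymm (.single hL) hle)
    · intro p q hip hpj hkq hql hpk hiq
      by_contra hcon
      have hpq : M p q = 0 := (h01 p q).resolve_right hcon
      have hpl : M p l = 1 := (hrows p hip hpj).symm.trans hpk
      have hjq : M j q = 1 := (hcols q hkq hql).symm.trans hiq
      have hne1 := hip.ne
      have hne2 := hpj.ne
      have hne3 := hkq.ne
      have hne4 := hql.ne
      have hK := interchangeStep_interchange hip hkq hik hiq hpk hpq
      have hL : InterchangeStep (interchange M i p k q)
          (interchange (interchange M i p k q) i j q l) := by
        apply interchangeStep_interchange hij hql <;> simp only [interchange] <;> grind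
      have hN : InterchangeStep (interchange (interchange M i p k q) i j q l) M' := by
        refine ⟨p, j, k, q, hpj, hkq, ?_⟩
        rw [hM']
        simp only [interchange]
        grind
      have heq := hno _ hK (.head hL (.single hN))
      have hle : secBLE M' _ := .single hN
      rw [heq] at hle
      exact hL.ne (secBLE.antisymm (.single hL) hle)
  · rintro ⟨h1, h2, h3, h4⟩
    have hw : CoverWindow M i j k l :=
      ⟨h01, hij, hkl, hik, hil, hjk, hjl, h1, h2, h3, h4⟩
    refine ⟨⟨.single hstep, hstep.ne⟩, ?_⟩
    rintro ⟨N, -, ⟨hle, hne⟩, hNM, hNM'⟩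
    rcases Relation.ReflTransGen.cases_head hNM with h | ⟨K, hK, hKN⟩
    · exact hNM' h.symm
    · have hKM' : K = M' := by
        rw [hM']
        exact hw.eq_interchange_of_step hK (hM' ▸ hKN.trans hle)
      subst hKM'
      exact hne (secBLE.antisymm hle hKN)
end

section
/- Let M be an m×n 0-1 matrix and let M' be obtained from M by a single L2→I2 interchange at rows i<j and columns k<l. Then for all p,q: σ(M')_{pq} = σ(M)_{pq} + 1 if i ≤ p < j and k ≤ q < l, and σ(M')_{pq} = σ(M)_{pq} otherwise. In particular σ(M') ≥ σ(M) entrywise and σ(M') ≠ σ(M), so M' is strictly below M in the combinatorial Bruhat order. -/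
open Finset

lemma sigmaM_add {m n : ℕ} (A B : Fin m → Fin n → ℕ) (p : Fin m) (q : Fin n) :
    sigmaM (fun x y => A x y + B x y) p q = sigmaM A p q + sigmaM B p q := by
  simp only [sigmaM, Finset.sum_add_distrib]

/-- The partial sums of the matrix unit at `(a, b)`. -/
lemma sigmaM_single {m n : ℕ} (a p : Fin m) (b q : Fin n) :
    sigmaM (fun x y => if x = a ∧ y = b then 1 else 0) p q =
      if a ≤ p ∧ b ≤ q then 1 else 0 := by
  simp only [sigmaM, ite_and]
  simp [Finset.sum_ite_irrel, Finset.sum_ite_eq']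

/-- Effect of a single `L2 → I2` interchange on the matrix of partial sums:
entries `σ(M)_{pq}` with `i ≤ p < j`, `k ≤ q < l` increase by one, the others are
unchanged; in particular `M'` is strictly below `M` in the combinatorial Bruhat order. -/
theorem sigma_of_interchange {m n : ℕ} (M M' : Fin m → Fin n → ℕ)
    (h01 : ∀ p q, M p q = 0 ∨ M p q = 1)
    (i j : Fin m) (k l : Fin n) (hij : i < j) (hkl : k < l)
    (hik : M i k = 0) (hil : M i l = 1) (hjk : M j k = 1) (hjl : M j l = 0)
    (hM' : M' = fun p q =>
      if (p = i ∧ q = k) ∨ (p = j ∧ q = l) then 1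
      else if (p = i ∧ q = l) ∨ (p = j ∧ q = k) then 0
      else M p q) :
    (∀ (p : Fin m) (q : Fin n),
        sigmaM M' p q = sigmaM M p q + (if i ≤ p ∧ p < j ∧ k ≤ q ∧ q < l then 1 else 0)) ∧
    (∀ (p : Fin m) (q : Fin n), sigmaM M p q ≤ sigmaM M' p q) ∧
    sigmaM M' ≠ sigmaM M ∧
    (bruhatLE M' M ∧ M' ≠ M) := by
  have entry : (fun x y => M' x y + ((if x = i ∧ y = l then 1 else 0) +
        (if x = j ∧ y = k then 1 else 0))) =
      fun x y => M x y + ((if x = i ∧ y = k then 1 else 0) +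
        (if x = j ∧ y = l then 1 else 0)) := by
    funext x y
    subst hM'
    have := hij.ne
    have := hkl.ne
    grind
  have key : ∀ (p : Fin m) (q : Fin n), sigmaM M' p q =
      sigmaM M p q + (if i ≤ p ∧ p < j ∧ k ≤ q ∧ q < l then 1 else 0) := by
    intro p q
    have h := congrArg (fun A => sigmaM A p q) entry
    simp only [sigmaM_add, sigmaM_single] at h
    grind
  have le : ∀ (p : Fin m) (q : Fin n), sigmaM M p q ≤ sigmaM M' p q :=
    fun p q => (key p q).symm ▸ Nat.le_add_right _ _
  have ne : sigmaM M' ≠ sigmaM M := by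
    intro h
    have hik' := key i k
    simp [h, hij, hkl] at hik'
  exact ⟨key, le, ne, le, fun h => ne (congrArg sigmaM h)⟩
end

section
/- Let r ∈ ℕ^m, c ∈ ℕ^n with equal coordinate sums. The combinatorial secondary Bruhat order ≤_{secB} is a partial order on BCT(r,c): it is reflexive, transitive, and antisymmetric (if M1 ≤_{secB} M2 and M2 ≤_{secB} M1 then M1 = M2). -/
open Finset

/-- The total of the entries of `M`, with the entry in position `(p, q)` weighted by `p * q`. -/
def weightedSum {m n : ℕ} (M : Fin m → Fin n → ℕ) : ℕ :=
  ∑ x : Fin m × Fin n, M x.1 x.2 * ((x.1 : ℕ) * (x.2 : ℕ))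

/-- An `L2 → I2` interchange strictly increases the weighted sum, by `(j - i) * (l - k)`. -/
theorem InterchangeStep.weightedSum_lt {m n : ℕ} {M M' : Fin m → Fin n → ℕ}
    (h : InterchangeStep M M') : weightedSum M < weightedSum M' := by
  obtain ⟨i, j, k, l, hij, hkl, h1, h2, h3, h4, h5, h6, h7, h8, hrest⟩ := h
  have entry : ∀ x : Fin m × Fin n,
      M' x.1 x.2 + (if x = (i, l) then 1 else 0) + (if x = (j, k) then 1 else 0) =
        M x.1 x.2 + (if x = (i, k) then 1 else 0) + (if x = (j, l) then 1 else 0) := by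
    rintro ⟨p, q⟩
    have hpq := hrest p q
    have hij' := hij.ne
    have hkl' := hkl.ne
    simp only [Prod.mk.injEq]
    grind
  have total : weightedSum M' + (i : ℕ) * l + (j : ℕ) * k =
      weightedSum M + (i : ℕ) * k + (j : ℕ) * l := by
    have := Finset.sum_congr rfl fun x (_ : x ∈ (univ : Finset (Fin m × Fin n))) =>
      congrArg (· * ((x.1 : ℕ) * (x.2 : ℕ))) (entry x)
    simpa [add_mul, Finset.sum_add_distrib, weightedSum] using this
  have hij' : (i : ℕ) < j := hij
  have hkl' : (k : ℕ) < l := hkl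
  nlinarith [mul_pos (sub_pos.2 (Int.ofNat_lt.2 hij')) (sub_pos.2 (Int.ofNat_lt.2 hkl'))]

/-- Descending in the secondary Bruhat order never decreases the weighted sum. -/
theorem secBLE.eq_or_weightedSum_lt {m n : ℕ} {M1 M2 : Fin m → Fin n → ℕ}
    (h : secBLE M1 M2) : M1 = M2 ∨ weightedSum M2 < weightedSum M1 := by
  induction h with
  | refl => exact Or.inl rfl
  | tail _ hstep ih =>
    right
    rcases ih with rfl | ih
    · exact hstep.weightedSum_lt
    · exact ih.trans hstep.weightedSum_lt

/-- The combinatorial secondary Bruhat order is a partial order on `BCT(r,c)`: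
reflexive, transitive, and antisymmetric. -/
theorem secB_partialOrder {m n : ℕ} (r : Fin m → ℕ) (c : Fin n → ℕ)
    (hsum : ∑ i, r i = ∑ j, c j) :
    (∀ M : Fin m → Fin n → ℕ, isBCT r c M → secBLE M M) ∧
    (∀ M1 M2 M3 : Fin m → Fin n → ℕ, isBCT r c M1 → isBCT r c M2 → isBCT r c M3 →
      secBLE M1 M2 → secBLE M2 M3 → secBLE M1 M3) ∧
    (∀ M1 M2 : Fin m → Fin n → ℕ, isBCT r c M1 → isBCT r c M2 →
      secBLE M1 M2 → secBLE M2 M1 → M1 = M2) := by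
  refine ⟨fun _ _ => Relation.ReflTransGen.refl, fun _ _ _ _ _ _ h12 h23 => h23.trans h12,
    fun M1 M2 _ _ h12 h21 => ?_⟩
  rcases h12.eq_or_weightedSum_lt with h | h
  · exact h
  · rcases h21.eq_or_weightedSum_lt with h' | h'
    · exact h'.symm
    · exact absurd h h'.asymm
end

section
/- Let M and M' be two n×2 0-1 matrices with equal row sum vectors and equal column sum vectors (i.e., both lie in a common set BCT(r,c) with c ∈ ℕ^2). Then M' ≤_{secB} M in the combinatorial secondary Bruhat order if and only if M' = M + Z for an n×2 integer matrix Z such that: (i) each row of Z is (0,0), (1,−1) or (−1,1); (ii) for every k ≤ n, the number of rows equal to (1,−1) among the first k rows of Z is at least the number of rows equal to (−1,1) among the first k rows of Z; (iii) the total number of (1,−1) rows of Z equals the total number of (−1,1) rows of Z. -/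
open Finset

/-- An interchange in a two-column matrix moves a one of the first column from row `j` up to
row `i`. -/
theorem InterchangeStep.exists_first_column {n : ℕ} {M M' : Fin n → Fin 2 → ℕ}
    (h : InterchangeStep M M') :
    ∃ i j : Fin n, i < j ∧
      ∀ p, M' p 0 + (if p = j then 1 else 0) = M p 0 + (if p = i then 1 else 0) := by
  obtain ⟨i, j, k, l, hij, hkl, h1, -, h3, -, h5, -, h7, -, hrest⟩ := h
  obtain rfl : k = 0 := by omega
  refine ⟨i, j, hij, fun p => ?_⟩
  have hp := hrest p 0
  grind

/-- Moving a one from position `j` up to position `i` does not decrease any prefix sum. -/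
theorem sum_prefix_le_of_move {n : ℕ} {f g : Fin n → ℕ} {i j : Fin n} (hij : i < j)
    (h : ∀ p, g p + (if p = j then 1 else 0) = f p + (if p = i then 1 else 0)) (K : ℕ) :
    ∑ p with p.val < K, f p ≤ ∑ p with p.val < K, g p := by
  have hsum := Finset.sum_congr (rfl : ({p | p.val < K} : Finset (Fin n)) = _)
    fun p _ => h p
  simp only [Finset.sum_add_distrib, Finset.sum_ite_eq', Finset.mem_filter,
    Finset.mem_univ, true_and] at hsum
  have : i.val < j.val := hij
  split_ifs at hsum <;> omega

/-- Moving a one from position `j` to position `i` preserves prefix sums that contain both. -/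
theorem sum_prefix_eq_of_move {n : ℕ} {f g : Fin n → ℕ} {i j : Fin n}
    (h : ∀ p, g p + (if p = j then 1 else 0) = f p + (if p = i then 1 else 0)) {K : ℕ}
    (hi : i.val < K) (hj : j.val < K) :
    ∑ p with p.val < K, g p = ∑ p with p.val < K, f p := by
  have hsum := Finset.sum_congr (rfl : ({p | p.val < K} : Finset (Fin n)) = _)
    fun p _ => h p
  simpa [Finset.sum_add_distrib, hi, hj] using hsum

/-- The secondary Bruhat order on two-column matrices implies dominance of the prefix sums of
the first column. -/
theorem secBLE.sum_prefix_le {n : ℕ} {M M' : Fin n → Fin 2 → ℕ} (h : secBLE M' M) (K : ℕ) :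
    ∑ p with p.val < K, M p 0 ≤ ∑ p with p.val < K, M' p 0 := by
  induction h with
  | refl => rfl
  | tail _ hstep ih =>
    obtain ⟨i, j, hij, hmove⟩ := hstep.exists_first_column
    exact ih.trans (sum_prefix_le_of_move hij hmove K)

theorem sum_prefix_self {n : ℕ} (f : Fin n → ℕ) : ∑ p with p.val < n, f p = ∑ p, f p := by
  simp

/-- If `f` and `g` are distinct, have equal sums and the prefix sums of `g` dominate those
of `f`, then the first descent `g j < f j` is preceded by an ascent `f i < g i`. -/
theorem exists_ascent_before_first_descent {n : ℕ} {f g : Fin n → ℕ} (hne : f ≠ g)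
    (htot : ∑ p, f p = ∑ p, g p)
    (hdom : ∀ K ≤ n, ∑ p with p.val < K, f p ≤ ∑ p with p.val < K, g p) :
    ∃ i j : Fin n, i < j ∧ f i < g i ∧ g j < f j ∧ ∀ p < j, f p ≤ g p := by
  have hex : ∃ j, g j < f j := by
    by_contra! hle
    exact hne (funext fun p =>
      (Finset.sum_eq_sum_iff_of_le fun p _ => hle p).1 htot p (Finset.mem_univ p))
  obtain ⟨j, hj, hmin⟩ := WellFounded.has_min (wellFounded_lt (α := Fin n)) {j | g j < f j} hex
  have hbefore : ∀ p < j, f p ≤ g p := fun p hp => not_lt.1 fun hlt => hmin p hlt hp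
  by_contra! hnone
  have hge : ∀ p < j, g p ≤ f p := fun p hp => not_lt.1 fun hlt => by
    obtain ⟨q, hq, hq'⟩ := hnone p j hp hlt hj
    exact absurd (hbefore q hq) (not_le.2 hq')
  refine absurd (hdom (j.val + 1) j.isLt)
    (not_le.2 (Finset.sum_lt_sum (fun p hp => ?_) ⟨j, ?_, hj⟩))
  · rcases (show p ≤ j by simp at hp; omega).lt_or_eq with h | rfl
    · exact hge p h
    · exact hj.le
  · simp

/-- Prefix dominance of the first columns implies the secondary Bruhat order. -/
theorem secBLE_of_sum_prefix_le {n : ℕ} {M M' : Fin n → Fin 2 → ℕ}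
    (h01 : ∀ p q, M p q = 0 ∨ M p q = 1) (h01' : ∀ p q, M' p q = 0 ∨ M' p q = 1)
    (hrow : ∀ p, M p 0 + M p 1 = M' p 0 + M' p 1) (htot : ∑ p, M p 0 = ∑ p, M' p 0)
    (hdom : ∀ K ≤ n, ∑ p with p.val < K, M p 0 ≤ ∑ p with p.val < K, M' p 0) :
    secBLE M' M := by
  induction hd : #{p | M p 0 ≠ M' p 0} using Nat.strong_induction_on generalizing M with
  | _ d ih =>
  by_cases hne : (fun p => M p 0) = fun p => M' p 0
  · have heq : M = M' := by
      ext p q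
      have h0 := congrFun hne p
      have := hrow p
      fin_cases q <;> simp at * <;> omega
    exact heq ▸ Relation.ReflTransGen.refl
  obtain ⟨i, j, hij, hi, hj, hbefore⟩ := exists_ascent_before_first_descent hne htot hdom
  let N : Fin n → Fin 2 → ℕ := fun p => if p = i ∨ p = j then M' p else M p
  have hN : ∀ p, N p = if p = i ∨ p = j then M' p else M p := fun _ => rfl
  have hi0 := h01 i 0
  have hi0' := h01' i 0
  have hj0 := h01 j 0
  have hj0' := h01' j 0
  have hi1 := h01 i 1
  have hj1' := h01' j 1
  have hri := hrow i
  have hrj := hrow j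
  have hmove : ∀ p, N p 0 + (if p = j then 1 else 0) = M p 0 + (if p = i then 1 else 0) := by
    intro p
    have := hij.ne
    grind
  have hstep : InterchangeStep M N := by
    refine ⟨i, j, 0, 1, hij, by simp, ?_⟩
    have hNi : N i = M' i := by simp [hN]
    have hNj : N j = M' j := by simp [hN]
    rw [hNi, hNj]
    refine ⟨by omega, by omega, by omega, by omega, by omega, by omega, by omega, by omega,
      fun p q hpq => ?_⟩
    have : ¬(p = i ∨ p = j) := fun h => hpq ⟨h, by omega⟩
    simp [hN, this]
  refine Relation.ReflTransGen.head hstep (ih _ ?_ ?_ ?_ ?_ ?_ rfl)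
  · rw [← hd]
    refine Finset.card_lt_card (Finset.ssubset_iff_of_subset ?_ |>.2 ⟨i, ?_, ?_⟩)
    · intro p
      simp only [Finset.mem_filter, Finset.mem_univ, true_and, hN]
      split_ifs <;> simp
    · simpa using hi.ne
    · simp [hN]
  · intro p q
    rw [hN]
    split_ifs
    exacts [h01' p q, h01 p q]
  · intro p
    rw [hN]
    split_ifs
    exacts [rfl, hrow p]
  · have := sum_prefix_eq_of_move hmove i.isLt j.isLt
    rw [sum_prefix_self, sum_prefix_self] at this
    exact this.trans htot
  · intro K hK
    rcases le_or_gt K j.val with hKj | hKj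
    · refine Finset.sum_le_sum fun p hp => ?_
      have hpj : p < j := Fin.lt_def.2 ((Finset.mem_filter.1 hp).2.trans_le hKj)
      rw [hN]
      split_ifs
      exacts [le_rfl, hbefore p hpj]
    · exact (sum_prefix_eq_of_move hmove (lt_trans hij hKj) hKj).trans_le (hdom K hK)

/-- For a difference matrix `Z` with rows `(0,0)`, `(1,-1)`, `(-1,1)`, counting rows of either
sign computes the change of the first column sum. -/
theorem sum_add_card_filter_eq {n : ℕ} {M M' : Fin n → Fin 2 → ℕ} {Z : Fin n → Fin 2 → ℤ}
    (hZ : ∀ p q, (M' p q : ℤ) = (M p q : ℤ) + Z p q)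
    (hrows : ∀ p, (Z p 0 = 0 ∧ Z p 1 = 0) ∨ (Z p 0 = 1 ∧ Z p 1 = -1) ∨
      (Z p 0 = -1 ∧ Z p 1 = 1)) (K : ℕ) :
    ∑ p with p.val < K, M' p 0 + #{p : Fin n | p.val < K ∧ Z p 0 = -1 ∧ Z p 1 = 1} =
      ∑ p with p.val < K, M p 0 + #{p : Fin n | p.val < K ∧ Z p 0 = 1 ∧ Z p 1 = -1} := by
  simp only [Finset.card_filter, Finset.sum_filter, ← Finset.sum_add_distrib]
  refine Finset.sum_congr rfl fun p _ => ?_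
  have h0 := hZ p 0
  rcases hrows p with ⟨ha, hb⟩ | ⟨ha, hb⟩ | ⟨ha, hb⟩ <;> simp [ha, hb] at h0 ⊢ <;>
    split_ifs <;> omega

/-- Characterization of the secondary Bruhat order for BCTs with exactly two columns:
`M' ≤ M` iff `M' = M + Z` where each row of `Z` is `(0,0)`, `(1,-1)` or `(-1,1)`,
every prefix contains at least as many `(1,-1)` rows as `(-1,1)` rows, and the total
numbers of `(1,-1)` and `(-1,1)` rows agree. -/
theorem two_column_characterization {n : ℕ} (M M' : Fin n → Fin 2 → ℕ)
    (h01 : ∀ p q, M p q = 0 ∨ M p q = 1) (h01' : ∀ p q, M' p q = 0 ∨ M' p q = 1)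
    (hrow : ∀ p, ∑ q, M p q = ∑ q, M' p q)
    (hcol : ∀ q, ∑ p, M p q = ∑ p, M' p q) :
    secBLE M' M ↔ ∃ Z : Fin n → Fin 2 → ℤ,
      (∀ p q, (M' p q : ℤ) = (M p q : ℤ) + Z p q) ∧
      (∀ p, (Z p 0 = 0 ∧ Z p 1 = 0) ∨ (Z p 0 = 1 ∧ Z p 1 = -1) ∨
        (Z p 0 = -1 ∧ Z p 1 = 1)) ∧
      (∀ K : ℕ, K ≤ n →
        (Finset.univ.filter (fun p : Fin n => p.val < K ∧ Z p 0 = -1 ∧ Z p 1 = 1)).card ≤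
        (Finset.univ.filter (fun p : Fin n => p.val < K ∧ Z p 0 = 1 ∧ Z p 1 = -1)).card) ∧
      (Finset.univ.filter (fun p : Fin n => Z p 0 = 1 ∧ Z p 1 = -1)).card =
        (Finset.univ.filter (fun p : Fin n => Z p 0 = -1 ∧ Z p 1 = 1)).card := by
  simp only [Fin.sum_univ_two] at hrow
  constructor
  · intro h
    have hZ : ∀ p q, (M' p q : ℤ) = (M p q : ℤ) + ((M' p q : ℤ) - M p q) := by
      intros; ring
    have hrows : ∀ p, ((M' p 0 : ℤ) - M p 0 = 0 ∧ (M' p 1 : ℤ) - M p 1 = 0) ∨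
        ((M' p 0 : ℤ) - M p 0 = 1 ∧ (M' p 1 : ℤ) - M p 1 = -1) ∨
        ((M' p 0 : ℤ) - M p 0 = -1 ∧ (M' p 1 : ℤ) - M p 1 = 1) := by
      intro p
      have := hrow p
      have := h01 p 0
      have := h01' p 0
      omega
    have hcount := sum_add_card_filter_eq (Z := fun p q => (M' p q : ℤ) - M p q) hZ hrows
    refine ⟨fun p q => (M' p q : ℤ) - M p q, hZ, hrows, fun K _ => ?_, ?_⟩ <;> beta_reduce
    · have := hcount K
      have := h.sum_prefix_le K
      omega
    · have := hcount n
      rw [sum_prefix_self, sum_prefix_self, hcol 0] at this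
      simp only [Fin.is_lt, true_and] at this
      omega
  · rintro ⟨Z, hZ, hrows, hprefix, -⟩
    refine secBLE_of_sum_prefix_le h01 h01' hrow (hcol 0) fun K hK => ?_
    have := sum_add_card_filter_eq hZ hrows K
    have := hprefix K hK
    omega
end

section
/- Let r ∈ ℕ^m, c ∈ ℕ^n with equal coordinate sums, let 1 ≤ k ≤ n with c_k ≥ 2, let c̃ ∈ ℕ^{n+1} be a resolution of c at index k with parts c_k', c_k'', and let q: BCT(r,c̃,c) → BCT(r,c) be the merge map. Then for every M ∈ BCT(r,c), the fiber q^{-1}(M) has exactly binomial(c_k, c_k') elements. -/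
open Finset

/-- The resolution of the charge vector `c` at index `k`: the entry `c k` is replaced by
the two consecutive entries `c'`, `c''`. -/
def resVec {n : ℕ} (c : Fin n → ℕ) (k : Fin n) (c' c'' : ℕ) : Fin (n + 1) → ℕ :=
  fun j =>
    if h : j.val < k.val then c ⟨j.val, by have := k.isLt; omega⟩
    else if j.val = k.val then c'
    else if j.val = k.val + 1 then c''
    else c ⟨j.val - 1, by have := j.isLt; have := k.isLt; omega⟩

/-- The condition defining `BCT(r, c̃, c) ⊆ BCT(r, c̃)`: the entries in columns `k` and
`k+1` of each row sum to at most `1`. -/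
def splitCond {m n : ℕ} (k : Fin n) (Mt : Fin m → Fin (n + 1) → ℕ) : Prop :=
  ∀ i, Mt i ⟨k.val, Nat.lt_succ_of_lt k.isLt⟩ + Mt i ⟨k.val + 1, Nat.succ_lt_succ k.isLt⟩ ≤ 1

/-- The merge map `q : BCT(r, c̃, c) → BCT(r, c)` replacing columns `k` and `k+1` by
their entrywise sum. -/
def mergeMat {m n : ℕ} (k : Fin n) (Mt : Fin m → Fin (n + 1) → ℕ) : Fin m → Fin n → ℕ :=
  fun i j =>
    if j.val < k.val then Mt i ⟨j.val, by have := j.isLt; omega⟩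
    else if j.val = k.val then
      Mt i ⟨k.val, Nat.lt_succ_of_lt k.isLt⟩ + Mt i ⟨k.val + 1, Nat.succ_lt_succ k.isLt⟩
    else Mt i ⟨j.val + 1, by have := j.isLt; omega⟩

theorem resVec_succ {n : ℕ} (c : Fin n → ℕ) (k : Fin n) (c' c'' : ℕ) :
    resVec c k c' c'' k.succ = c'' := by
  simp [resVec]

theorem resVec_succAbove {n : ℕ} (c : Fin n → ℕ) (k : Fin n) (c' c'' : ℕ) (j : Fin n) :
    resVec c k c' c'' (k.succ.succAbove j) = if j = k then c' else c j := by
  rcases lt_trichotomy j k with h | rfl | h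
  · rw [Fin.succAbove_succ_of_le _ _ h.le]
    simp [resVec, h.ne, Fin.lt_def.mp h]
  · simp [resVec]
  · rw [Fin.succAbove_succ_of_lt _ _ h]
    have h' := Fin.lt_def.mp h
    simp [resVec, h.ne', h'.ne', show ¬ j.val + 1 < k.val by omega,
      show ¬ j.val + 1 = k.val by omega]

theorem mergeMat_apply {m n : ℕ} (k : Fin n) (Mt : Fin m → Fin (n + 1) → ℕ) (i : Fin m)
    (j : Fin n) :
    mergeMat k Mt i j = Mt i (k.succ.succAbove j) + if j = k then Mt i k.succ else 0 := by
  rcases lt_trichotomy j k with h | rfl | h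
  · rw [Fin.succAbove_succ_of_le _ _ h.le]
    simp [mergeMat, h.ne, h]
    rfl
  · simp [mergeMat]
    rfl
  · rw [Fin.succAbove_succ_of_lt _ _ h]
    simp [mergeMat, h.ne', h.not_gt, Fin.val_inj]
    rfl

theorem sum_mergeMat {m n : ℕ} (k : Fin n) (Mt : Fin m → Fin (n + 1) → ℕ) (i : Fin m) :
    ∑ j, mergeMat k Mt i j = ∑ j, Mt i j := by
  simp [mergeMat_apply, sum_add_distrib, Fin.sum_univ_succAbove (Mt i) k.succ, add_comm]

/-- A matrix lies in the fiber over `M` iff it agrees with `M` away from the split column,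
its two new columns add up to that column, and the first of them has sum `c'`. -/
theorem mem_fiber_iff {m n : ℕ} {r : Fin m → ℕ} {c : Fin n → ℕ} {k : Fin n} {c' c'' : ℕ}
    (hsplit : c' + c'' = c k) {M : Fin m → Fin n → ℕ} (hM : isBCT r c M)
    (Mt : Fin m → Fin (n + 1) → ℕ) :
    (isBCT r (resVec c k c' c'') Mt ∧ splitCond k Mt ∧ mergeMat k Mt = M) ↔
      mergeMat k Mt = M ∧ ∑ i, Mt i k.castSucc = c' := by
  obtain ⟨h01, hr, hc⟩ := hM
  constructor
  · rintro ⟨⟨-, -, hcol⟩, -, hq⟩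
    refine ⟨hq, ?_⟩
    simpa [resVec_succAbove] using
      (hcol (k.succ.succAbove k)).trans (resVec_succAbove c k c' c'' k)
  · rintro ⟨rfl, hsum⟩
    have hk (i) : mergeMat k Mt i k = Mt i k.castSucc + Mt i k.succ := by
      simp [mergeMat_apply]
    have hne (i) {j} (hj : j ≠ k) : mergeMat k Mt i j = Mt i (k.succ.succAbove j) := by
      simp [mergeMat_apply, hj]
    refine ⟨⟨fun i j => ?_, fun i => sum_mergeMat k Mt i ▸ hr i, fun j => ?_⟩, fun i => ?_, rfl⟩
    · have hik := h01 i k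
      rw [hk] at hik
      rcases Fin.eq_self_or_eq_succAbove k.succ j with rfl | ⟨j, rfl⟩
      · omega
      · rcases eq_or_ne j k with rfl | hj
        · rw [Fin.succAbove_succ_self]
          omega
        · exact hne i hj ▸ h01 i j
    · have hck := hc k
      simp only [hk, sum_add_distrib] at hck
      rcases Fin.eq_self_or_eq_succAbove k.succ j with rfl | ⟨j, rfl⟩
      · rw [resVec_succ]
        omega
      · rw [resVec_succAbove]
        split_ifs with hj
        · subst hj
          simpa using hsum
        · simp only [← hc j, hne _ hj]
    · change Mt i k.castSucc + Mt i k.succ ≤ 1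
      have hik := h01 i k
      rw [hk] at hik
      omega

/-- Splits column `k` of `M` into its restrictions to the rows in `T` and outside `T`. -/
def splitMat {m n : ℕ} (k : Fin n) (M : Fin m → Fin n → ℕ) (T : Finset (Fin m)) :
    Fin m → Fin (n + 1) → ℕ :=
  fun i => k.succ.insertNth (α := fun _ => ℕ) (if i ∈ T then 0 else M i k)
    (fun j => if j = k ∧ i ∉ T then 0 else M i j)

theorem splitMat_succ {m n : ℕ} (k : Fin n) (M : Fin m → Fin n → ℕ) (T : Finset (Fin m))
    (i : Fin m) : splitMat k M T i k.succ = if i ∈ T then 0 else M i k := by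
  simp [splitMat]

theorem splitMat_succAbove {m n : ℕ} (k : Fin n) (M : Fin m → Fin n → ℕ) (T : Finset (Fin m))
    (i : Fin m) (j : Fin n) :
    splitMat k M T i (k.succ.succAbove j) = if j = k ∧ i ∉ T then 0 else M i j := by
  simp [splitMat]

theorem splitMat_castSucc {m n : ℕ} (k : Fin n) (M : Fin m → Fin n → ℕ) (T : Finset (Fin m))
    (i : Fin m) : splitMat k M T i k.castSucc = if i ∈ T then M i k else 0 := by
  simpa using splitMat_succAbove k M T i k

theorem mergeMat_splitMat {m n : ℕ} (k : Fin n) (M : Fin m → Fin n → ℕ)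
    (T : Finset (Fin m)) : mergeMat k (splitMat k M T) = M := by
  ext i j
  rw [mergeMat_apply, splitMat_succAbove, splitMat_succ]
  by_cases hj : j = k <;> by_cases hi : i ∈ T <;> simp [hj, hi]

/-- The fiber over a `0`-`1` matrix `M` consists of the splittings of column `k` along the
`c'`-subsets of its support. -/
def fiberEquiv {m n : ℕ} {k : Fin n} {M : Fin m → Fin n → ℕ}
    (h01 : ∀ i, M i k = 0 ∨ M i k = 1) (c' : ℕ) :
    {Mt : Fin m → Fin (n + 1) → ℕ // mergeMat k Mt = M ∧ ∑ i, Mt i k.castSucc = c'} ≃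
      powersetCard c' (univ.filter fun i => M i k = 1) where
  toFun Mt := ⟨univ.filter fun i => Mt.1 i k.castSucc = 1, by
    obtain ⟨Mt, rfl, rfl⟩ := Mt
    have hk (i) : mergeMat k Mt i k = Mt i k.castSucc + Mt i k.succ := by
      simp [mergeMat_apply]
    simp only [hk] at h01
    rw [mem_powersetCard]
    constructor
    · intro i
      have := h01 i
      simp only [mem_filter, mem_univ, true_and, hk]
      omega
    · rw [card_filter]
      refine sum_congr rfl fun i _ => ?_
      have := h01 i
      dsimp only
      split_ifs <;> omega⟩
  invFun T := ⟨splitMat k M T.1, mergeMat_splitMat k M T.1, by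
    obtain ⟨T, hT⟩ := T
    obtain ⟨hsub, rfl⟩ := mem_powersetCard.mp hT
    simp only [splitMat_castSucc, sum_ite_mem, univ_inter]
    rw [sum_congr rfl fun i hi => (mem_filter.mp (hsub hi)).2, card_eq_sum_ones]⟩
  left_inv := by
    rintro ⟨Mt, rfl, rfl⟩
    ext i j
    have h := h01 i
    simp only [mergeMat_apply, Fin.succAbove_succ_self, if_true] at h
    rcases Fin.eq_self_or_eq_succAbove k.succ j with rfl | ⟨j, rfl⟩
    · simp only [splitMat_succ, mergeMat_apply, Fin.succAbove_succ_self, mem_filter, mem_univ,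
        true_and, if_true]
      split_ifs <;> omega
    · simp only [splitMat_succAbove, mergeMat_apply, mem_filter, mem_univ, true_and]
      rcases eq_or_ne j k with rfl | hj
      · simp only [Fin.succAbove_succ_self, true_and, if_true]
        split_ifs <;> omega
      · simp [hj]
  right_inv := by
    rintro ⟨T, hT⟩
    ext i
    have hi := @(mem_powersetCard.mp hT).1 i
    by_cases h : i ∈ T <;> simp_all [splitMat_castSucc]

/-- The fiber of the merge map `q : BCT(r, c̃, c) → BCT(r, c)` over any `M ∈ BCT(r,c)`
has exactly `(c_k choose c_k')` elements. -/
theorem resolution_fiber_card {m n : ℕ} (r : Fin m → ℕ) (c : Fin n → ℕ)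
    (hsum : ∑ i, r i = ∑ j, c j) (k : Fin n) (c' c'' : ℕ)
    (hck : 2 ≤ c k) (hc' : 0 < c') (hc'' : 0 < c'') (hsplit : c' + c'' = c k)
    (M : Fin m → Fin n → ℕ) (hM : isBCT r c M) :
    Nat.card {Mt : Fin m → Fin (n + 1) → ℕ //
        isBCT r (resVec c k c' c'') Mt ∧ splitCond k Mt ∧ mergeMat k Mt = M} =
      Nat.choose (c k) c' := by
  rw [Nat.card_congr ((Equiv.subtypeEquivRight (mem_fiber_iff hsplit hM)).trans
    (fiberEquiv (fun i => hM.1 i k) c')), Nat.card_eq_fintype_card, Fintype.card_coe,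
    card_powersetCard, card_filter, ← hM.2.2 k]
  congr 1
  refine sum_congr rfl fun i _ => ?_
  rcases hM.1 i k with h | h <;> simp [h]
end

section
/- Let M = (m_{ij}) be an m×n 0-1 matrix, k < l columns and i ≤ j rows such that the submatrix M[{i,...,j},{k,l}] is a minimal matched block. If the top row of the block is (0,1) (i.e. m_{ik}=0 and m_{il}=1), then the bottom row is (1,0) (i.e. m_{jk}=1 and m_{jl}=0); and conversely, if the top row is (1,0) then the bottom row is (0,1). -/
open Finset

/-- Sum of the entries of column `q` of `M` over the rows `p` with `a ≤ p ≤ b`. -/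
def blockSum {m n : ℕ} (M : Fin m → Fin n → ℕ) (a b : ℕ) (q : Fin n) : ℕ :=
  ∑ p ∈ Finset.univ.filter (fun p : Fin m => a ≤ p.val ∧ p.val ≤ b), M p q

/-- The two-column submatrix `M[{a,...,b},{k,l}]` is a matched block: its two columns
have equal sums. -/
def MatchedBlock {m n : ℕ} (M : Fin m → Fin n → ℕ) (a b : ℕ) (k l : Fin n) : Prop :=
  blockSum M a b k = blockSum M a b l

/-- A matched block is minimal if it cannot be partitioned into two matched sub-blocks. -/
def MinimalMatchedBlock {m n : ℕ} (M : Fin m → Fin n → ℕ) (a b : ℕ) (k l : Fin n) : Prop :=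
  MatchedBlock M a b k l ∧
    ¬ ∃ t : ℕ, a ≤ t ∧ t < b ∧ MatchedBlock M a t k l ∧ MatchedBlock M (t + 1) b k l

theorem blockSum_self {m n : ℕ} (M : Fin m → Fin n → ℕ) (i : Fin m) (q : Fin n) :
    blockSum M i.val i.val q = M i q := by
  have h : Finset.univ.filter (fun p : Fin m => i.val ≤ p.val ∧ p.val ≤ i.val) = {i} := by
    ext p
    simp only [Finset.mem_filter, Finset.mem_univ, true_and, Finset.mem_singleton, Fin.ext_iff]
    omega
  rw [blockSum, h, Finset.sum_singleton]

theorem blockSum_split {m n : ℕ} (M : Fin m → Fin n → ℕ) {a t b : ℕ} (hat : a ≤ t) (htb : t < b)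
    (q : Fin n) : blockSum M a b q = blockSum M a t q + blockSum M (t + 1) b q := by
  unfold blockSum
  rw [← Finset.sum_union]
  · congr 1
    ext p
    simp only [Finset.mem_filter, Finset.mem_univ, true_and, Finset.mem_union]
    omega
  · rw [Finset.disjoint_filter]
    intro p _ _
    omega

/-- Proper initial segments of a minimal matched block with top row `(0,1)` have strictly
smaller sum in the first column. -/
theorem MinimalMatchedBlock.blockSum_lt {m n : ℕ} {M : Fin m → Fin n → ℕ}
    (h01 : ∀ p q, M p q = 0 ∨ M p q = 1) {i j : Fin m} {k l : Fin n}
    (hmin : MinimalMatchedBlock M i.val j.val k l) (hk : M i k = 0) (hl : M i l = 1)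
    {t : ℕ} (hit : i.val ≤ t) (htj : t < j.val) :
    blockSum M i.val t k < blockSum M i.val t l := by
  induction t, hit using Nat.le_induction with
  | base => rw [blockSum_self, blockSum_self, hk, hl]; exact Nat.zero_lt_one
  | succ t hit ih =>
    have hlt := ih (by omega)
    have hstep (q : Fin n) :
        blockSum M i.val (t + 1) q = blockSum M i.val t q + M ⟨t + 1, by omega⟩ q := by
      rw [blockSum_split M hit (Nat.lt_succ_self t), ← blockSum_self M ⟨t + 1, by omega⟩ q]
    have hne : blockSum M i.val (t + 1) k ≠ blockSum M i.val (t + 1) l := fun heq => by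
      refine hmin.2 ⟨t + 1, by omega, htj, heq, ?_⟩
      have htotal : blockSum M i.val j.val k = blockSum M i.val j.val l := hmin.1
      rw [blockSum_split M (by omega) htj k, blockSum_split M (by omega) htj l] at htotal
      unfold MatchedBlock
      omega
    have := h01 ⟨t + 1, by omega⟩ k
    rw [hstep, hstep] at hne ⊢
    omega

theorem MinimalMatchedBlock.bottom_of_top {m n : ℕ} {M : Fin m → Fin n → ℕ}
    (h01 : ∀ p q, M p q = 0 ∨ M p q = 1) {i j : Fin m} {k l : Fin n} (hij : i ≤ j)
    (hmin : MinimalMatchedBlock M i.val j.val k l) (hk : M i k = 0) (hl : M i l = 1) :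
    M j k = 1 ∧ M j l = 0 := by
  have htotal : blockSum M i.val j.val k = blockSum M i.val j.val l := hmin.1
  rcases hij.eq_or_lt with rfl | hlt
  · rw [blockSum_self, blockSum_self] at htotal
    omega
  · have hlt : i.val < j.val := hlt
    have hstep (q : Fin n) :
        blockSum M i.val j.val q = blockSum M i.val (j.val - 1) q + M j q := by
      rw [blockSum_split M (t := j.val - 1) (by omega) (by omega),
        Nat.sub_add_cancel (by omega), blockSum_self]
    have := hmin.blockSum_lt h01 hk hl (t := j.val - 1) (by omega) (by omega)
    have := h01 j k
    have := h01 j l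
    rw [hstep, hstep] at htotal
    omega

theorem MinimalMatchedBlock.symm {m n : ℕ} {M : Fin m → Fin n → ℕ} {a b : ℕ} {k l : Fin n}
    (h : MinimalMatchedBlock M a b k l) : MinimalMatchedBlock M a b l k :=
  ⟨Eq.symm h.1, fun ⟨t, hat, htb, h₁, h₂⟩ => h.2 ⟨t, hat, htb, Eq.symm h₁, Eq.symm h₂⟩⟩

/-- In a minimal matched block, if the top row is `(0,1)` then the bottom row is `(1,0)`,
and conversely. -/
theorem minimal_block_top_bottom {m n : ℕ} (M : Fin m → Fin n → ℕ)
    (h01 : ∀ p q, M p q = 0 ∨ M p q = 1)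
    (i j : Fin m) (k l : Fin n) (hij : i ≤ j) (hkl : k < l)
    (hmin : MinimalMatchedBlock M i.val j.val k l) :
    ((M i k = 0 ∧ M i l = 1) → (M j k = 1 ∧ M j l = 0)) ∧
    ((M i k = 1 ∧ M i l = 0) → (M j k = 0 ∧ M j l = 1)) := by
  refine ⟨fun h => hmin.bottom_of_top h01 hij h.1 h.2, fun h => ?_⟩
  exact (hmin.symm.bottom_of_top h01 hij h.2 h.1).symm
end

section
/- Let r ∈ ℕ^m, c ∈ ℕ^n with equal coordinate sums and BCT(r,c) nonempty. Then the graph whose vertex set is BCT(r,c), with an edge between two matrices whenever they differ only in the four entries at the intersection of two rows i<j and two columns k<l, where one matrix has the pattern (0,1;1,0) and the other the pattern (1,0;0,1) at these positions, is connected. -/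
open Finset

/-- Reversing the pattern `(0,1;1,0)` at rows `i, j` and columns `k, l`, in whatever order they
come, stays in the class and is an edge of the interchange graph. -/
theorem isBCT.exists_interchange {m n : ℕ} {r : Fin m → ℕ} {c : Fin n → ℕ}
    {M : Fin m → Fin n → ℕ} (hM : isBCT r c M) {i j : Fin m} {k l : Fin n}
    (hik : M i k = 0) (hil : M i l = 1) (hjk : M j k = 1) (hjl : M j l = 0) :
    ∃ M', isBCT r c M' ∧ (InterchangeStep M M' ∨ InterchangeStep M' M) ∧
      M' i l = 0 ∧ M' j l = 1 ∧
      ∀ p q, ¬((p = i ∨ p = j) ∧ (q = k ∨ q = l)) → M' p q = M p q := by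
  obtain ⟨h01, hr, hc⟩ := hM
  have hij : i ≠ j := by rintro rfl; omega
  have hkl : k ≠ l := by rintro rfl; omega
  let M' : Fin m → Fin n → ℕ := fun p q => if q = k ∨ q = l then M (Equiv.swap i j p) q else M p q
  have hrow : ∀ p q, M' p q = if p = i ∨ p = j then M p (Equiv.swap k l q) else M p q := by
    intro p q
    simp only [M', Equiv.swap_apply_def]
    grind
  have eik : M' i k = 1 := by simp [M', hjk]
  have eil : M' i l = 0 := by simp [M', hjl]
  have ejk : M' j k = 0 := by simp [M', hik]
  have ejl : M' j l = 1 := by simp [M', hil]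
  have hoff : ∀ p q, ¬((p = i ∨ p = j) ∧ (q = k ∨ q = l)) → M' p q = M p q := by
    intro p q hpq
    rw [hrow]
    split_ifs with hp
    · have hq : ¬(q = k ∨ q = l) := fun hq => hpq ⟨hp, hq⟩
      rw [not_or] at hq
      rw [Equiv.swap_apply_of_ne_of_ne hq.1 hq.2]
    · rfl
  refine ⟨M', ⟨fun p q => ?_, fun p => ?_, fun q => ?_⟩, ?_, eil, ejl, hoff⟩
  · simp only [M']
    split_ifs <;> exact h01 _ _
  · simp only [hrow]
    split_ifs
    · rw [Equiv.sum_comp (Equiv.swap k l) (M p), hr]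
    · exact hr p
  · simp only [M']
    split_ifs
    · rw [Equiv.sum_comp (Equiv.swap i j) (fun p => M p q), hc]
    · exact hc q
  · rcases hij.lt_or_gt with h | h <;> rcases hkl.lt_or_gt with h' | h'
    · exact .inl ⟨i, j, k, l, h, h', hik, hil, hjk, hjl, eik, eil, ejk, ejl, hoff⟩
    · exact .inr ⟨i, j, l, k, h, h', eil, eik, ejl, ejk, hil, hik, hjl, hjk,
        fun p q hpq => (hoff p q (by tauto)).symm⟩
    · exact .inr ⟨j, i, k, l, h, h', ejk, ejl, eik, eil, hjk, hjl, hik, hil,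
        fun p q hpq => (hoff p q (by tauto)).symm⟩
    · exact .inl ⟨j, i, l, k, h, h', hjl, hjk, hil, hik, ejl, ejk, eil, eik,
        fun p q hpq => hoff p q (by tauto)⟩

/-- Two functions with equal sums that differ somewhere are strictly ordered somewhere. -/
theorem exists_lt_of_sum_eq_of_ne {ι : Type*} [Fintype ι] {f g : ι → ℕ}
    (h : ∑ x, f x = ∑ x, g x) (hne : f ≠ g) : ∃ x, f x < g x := by
  by_contra! hle
  exact hne (funext fun x =>
    ((Finset.sum_eq_sum_iff_of_le fun x _ => hle x).mp h.symm x (mem_univ x)).symm)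

/-- If two matrices with the same row sums agree outside the columns `l` and `S`, and rows `i`, `j`
are oppositely ordered at column `l`, then one of the matrices admits an interchange in these rows
using the column `l` and a column of `S`. -/
theorem isBCT.exists_interchange_column {m n : ℕ} {r : Fin m → ℕ} {c : Fin n → ℕ}
    {A B : Fin m → Fin n → ℕ} (hA : isBCT r c A) (hB : isBCT r c B)
    {S : Finset (Fin n)} {l : Fin n} (hl : l ∉ S)
    (hAB : ∀ p, ∀ q ∉ insert l S, A p q = B p q)
    {i j : Fin m} (hAi : A i l = 1) (hAj : A j l = 0) (hBi : B i l = 0) (hBj : B j l = 1) :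
    ∃ k ∈ S, (A i k = 0 ∧ A j k = 1) ∨ (B i k = 1 ∧ B j k = 0) := by
  by_contra! hno
  have key : ∀ p, ∑ q ∈ insert l S, A p q = ∑ q ∈ insert l S, B p q := by
    intro p
    have h1 := Finset.sum_add_sum_compl (insert l S) (A p)
    have h2 := Finset.sum_add_sum_compl (insert l S) (B p)
    have h3 : ∑ q ∈ (insert l S)ᶜ, A p q = ∑ q ∈ (insert l S)ᶜ, B p q :=
      Finset.sum_congr rfl fun q hq => hAB p q (Finset.mem_compl.mp hq)
    rw [hA.2.1] at h1
    rw [hB.2.1] at h2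
    omega
  have hSA : ∑ q ∈ S, A j q ≤ ∑ q ∈ S, A i q := Finset.sum_le_sum fun q hq => by
    have := (hno q hq).1
    have := hA.1 i q
    have := hA.1 j q
    omega
  have hSB : ∑ q ∈ S, B i q ≤ ∑ q ∈ S, B j q := Finset.sum_le_sum fun q hq => by
    have := (hno q hq).2
    have := hB.1 i q
    have := hB.1 j q
    omega
  have hi := key i
  have hj := key j
  rw [Finset.sum_insert hl, Finset.sum_insert hl] at hi hj
  omega

/-- Two matrices of the class that agree outside a set of columns are joined by a path. -/
theorem isBCT.reflTransGen_of_eq_off {m n : ℕ} {r : Fin m → ℕ} {c : Fin n → ℕ}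
    (S : Finset (Fin n)) : ∀ A B : Fin m → Fin n → ℕ, isBCT r c A → isBCT r c B →
      (∀ p, ∀ q ∉ S, A p q = B p q) →
      Relation.ReflTransGen (fun A B => InterchangeStep A B ∨ InterchangeStep B A) A B := by
  induction S using Finset.induction_on with
  | empty =>
    intro A B _ _ hAB
    obtain rfl : A = B := funext fun p => funext fun q => hAB p q (Finset.notMem_empty q)
    exact .refl
  | insert l S hl ih =>
    intro A B hA hB hAB
    induction hN : #{p | A p l ≠ B p l} using Nat.strong_induction_on generalizing A B with
    | _ N ihN =>
    by_cases heq : (fun p => A p l) = fun p => B p l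
    · refine ih A B hA hB fun p q hq => ?_
      by_cases hql : q = l
      · subst hql
        exact congrFun heq p
      · exact hAB p q (by simp [hql, hq])
    have hsum : ∑ p, A p l = ∑ p, B p l := (hA.2.2 l).trans (hB.2.2 l).symm
    obtain ⟨j, hj⟩ := exists_lt_of_sum_eq_of_ne hsum heq
    obtain ⟨i, hi⟩ := exists_lt_of_sum_eq_of_ne hsum.symm (Ne.symm heq)
    have := hA.1 i l
    have := hA.1 j l
    have := hB.1 i l
    have := hB.1 j l
    have hAi : A i l = 1 := by omega
    have hAj : A j l = 0 := by omega
    have hBi : B i l = 0 := by omega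
    have hBj : B j l = 1 := by omega
    obtain ⟨k, hk, ⟨hik, hjk⟩ | ⟨hik, hjk⟩⟩ :=
      hA.exists_interchange_column hB hl hAB hAi hAj hBi hBj
    · obtain ⟨A', hA', hstep, hi', hj', hoff⟩ := hA.exists_interchange hik hAi hjk hAj
      refine .head hstep (ihN _ ?_ A' B hA' hB (fun p q hq => ?_) rfl)
      · rw [← hN]
        refine Finset.card_lt_card (Finset.ssubset_iff_of_subset (fun p => ?_) |>.mpr ⟨i, ?_⟩)
        · simp only [Finset.mem_filter_univ]
          grind
        · simp [hAi, hBi, hi']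
      · rw [hoff p q (by grind), hAB p q hq]
    · obtain ⟨B', hB', hstep, hj', hi', hoff⟩ := hB.exists_interchange hjk hBj hik hBi
      refine .tail (ihN _ ?_ A B' hA hB' (fun p q hq => ?_) rfl) hstep.symm
      · rw [← hN]
        refine Finset.card_lt_card (Finset.ssubset_iff_of_subset (fun p => ?_) |>.mpr ⟨i, ?_⟩)
        · simp only [Finset.mem_filter_univ]
          grind
        · simp [hAi, hBi, hi']
      · rw [hoff p q (by grind), hAB p q hq]

/-- Ryser: the interchange graph on `BCT(r,c)` (edges given by `L2 ↔ I2` interchanges,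
in either direction) is connected. -/
theorem interchange_graph_connected {m n : ℕ} (r : Fin m → ℕ) (c : Fin n → ℕ)
    (hsum : ∑ i, r i = ∑ j, c j) (hne : ∃ M, isBCT r c M) :
    ∀ M1 M2 : Fin m → Fin n → ℕ, isBCT r c M1 → isBCT r c M2 →
      Relation.ReflTransGen (fun A B => InterchangeStep A B ∨ InterchangeStep B A) M1 M2 := by
  exact fun M1 M2 h1 h2 =>
    isBCT.reflTransGen_of_eq_off univ M1 M2 h1 h2 fun _ q hq => absurd (mem_univ q) hq
end
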